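/- Let m, λ be real constants with m ≠ 0, let A : ℝ → ℝ be three times differentiable with A(t) ≠ 0 for all t, and let U : ℝ³ → ℝ be differentiable. On ℝ⁴ with coordinates (t,x,y,z), consider the Bianchi V metric diag(−A²e^{mλt}, A²e^{mλt}, A²e^{2x}e^{m(λ−1)t}, A²e^{2x}), the conformal Killing vector ξ = (2/m, 0, y, λz) with conformal factor ψ(t) = (2/m)·A′(t)/A(t) + λ, and the potential V(t,x,y,z) = (e^{−mλt}/A(t)²)·U(x, y·e^{−mt/2}, z·e^{−mλt/2}) + e^{−mλt}·(m(λ−1)·A′(t) + 2A″(t))/(2A(t)³). Then the Lie/Noether symmetry constraint of the Klein–Gordon equation holds identically: for all (t,x,y,z), (2/m)·∂_tV + y·∂_yV + λz·∂_zV + 2ψ·V + Δψ = 0, where Δψ(t) = −(e^{−mλt}/A(t)²)·[ψ″(t) + (2A′(t)/A(t) + m(λ−1)/2)·ψ′(t)] is the Laplace–Beltrami operator of the metric applied to ψ. -/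

import Mathlib

noncomputable section

/-- Partial derivative of `f` in the `μ`-th coordinate direction at `p`. -/
def pd (μ : Fin 4) (f : (Fin 4 → ℝ) → ℝ) (p : Fin 4 → ℝ) : ℝ :=
  fderiv ℝ f p (Pi.single μ 1)

/-- A linear combination of partial derivatives is the derivative along any curve with that
velocity. -/
lemma hasDerivAt_comp_curve_pd {f : (Fin 4 → ℝ) → ℝ} {γ : ℝ → Fin 4 → ℝ} {v : Fin 4 → ℝ} {s : ℝ}
    (hf : DifferentiableAt ℝ f (γ s)) (hγ : HasDerivAt γ v s) :
    HasDerivAt (fun r => f (γ r)) (∑ μ, v μ * pd μ f (γ s)) s := by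
  have h := hf.hasFDerivAt.comp_hasDerivAt s hγ
  have hv : fderiv ℝ f (γ s) v = ∑ μ, v μ * pd μ f (γ s) := by
    conv_lhs => rw [pi_eq_sum_univ' v]
    simp [pd, map_sum]
  rwa [hv] at h

/-- The flow of `(2/m)∂_t + y∂_y + λz∂_z` through `p`. -/
def conformalFlow (m lam : ℝ) (p : Fin 4 → ℝ) (s : ℝ) : Fin 4 → ℝ :=
  ![p 0 + 2 / m * s, p 1, p 2 * Real.exp s, p 3 * Real.exp (lam * s)]

lemma conformalFlow_zero (m lam : ℝ) (p : Fin 4 → ℝ) : conformalFlow m lam p 0 = p := by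
  ext i
  fin_cases i <;> simp [conformalFlow]

lemma hasDerivAt_conformalFlow_zero (m lam : ℝ) (p : Fin 4 → ℝ) :
    HasDerivAt (conformalFlow m lam p) ![2 / m, 0, p 2, lam * p 3] 0 := by
  rw [hasDerivAt_pi]
  intro i
  fin_cases i
  · simpa [conformalFlow] using ((hasDerivAt_id (0 : ℝ)).const_mul (2 / m)).const_add (p 0)
  · simpa [conformalFlow] using hasDerivAt_const (0 : ℝ) (p 1)
  · simpa [conformalFlow] using (Real.hasDerivAt_exp 0).const_mul (p 2)
  · simpa [conformalFlow, mul_comm] using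
      ((hasDerivAt_id (0 : ℝ)).const_mul lam).exp.const_mul (p 3)

/-- STATEMENT: for the Bianchi V metric, the CKV `ξ = (2/m)∂_t + y∂_y + λz∂_z` with
conformal factor `ψ = (2/m)A′/A + λ` and the potential
`V = (e^{−mλt}/A²)·U(x, ye^{−mt/2}, ze^{−mλt/2}) + e^{−mλt}(m(λ−1)A′ + 2A″)/(2A³)`,
the Lie/Noether symmetry constraint `ξ^ν ∂_ν V + 2ψV + Δψ = 0` of the Klein-Gordon
equation holds. -/
theorem bianchiV_X3_potential_constraint (m lam : ℝ) (hm : m ≠ 0)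
    (A : ℝ → ℝ) (hA : ContDiff ℝ 3 A) (hA0 : ∀ t, A t ≠ 0)
    (U : (Fin 3 → ℝ) → ℝ) (hU : Differentiable ℝ U)
    (ψ : ℝ → ℝ) (hψ : ψ = fun t => (2 / m) * deriv A t / A t + lam)
    (Δψ : ℝ → ℝ)
    (hΔψ : Δψ = fun t => -(Real.exp (-(m * lam * t)) / (A t) ^ 2) *
      (deriv (deriv ψ) t + (2 * deriv A t / A t + m * (lam - 1) / 2) * deriv ψ t))
    (V : (Fin 4 → ℝ) → ℝ)
    (hV : V = fun p =>
      (Real.exp (-(m * lam * p 0)) / (A (p 0)) ^ 2) *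
        U ![p 1, p 2 * Real.exp (-(m * p 0) / 2), p 3 * Real.exp (-(m * lam * p 0) / 2)]
      + Real.exp (-(m * lam * p 0)) *
          (m * (lam - 1) * deriv A (p 0) + 2 * deriv (deriv A) (p 0)) /
          (2 * (A (p 0)) ^ 3)) :
    ∀ p : Fin 4 → ℝ,
      (2 / m) * pd 0 V p + p 2 * pd 2 V p + lam * p 3 * pd 3 V p
        + 2 * ψ (p 0) * V p + Δψ (p 0) = 0 := by
  intro p
  have hd1 : ContDiff ℝ 2 (deriv A) := ContDiff.deriv' (n := 2) (by rwa [two_add_one_eq_three])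
  have hd2 : ContDiff ℝ 1 (deriv (deriv A)) := ContDiff.deriv' (n := 1) (by rwa [one_add_one_eq_two])
  have hDA : Differentiable ℝ A := hA.differentiable (by norm_num)
  have hDA1 : Differentiable ℝ (deriv A) := hd1.differentiable (by norm_num)
  have hDA2 : Differentiable ℝ (deriv (deriv A)) := hd2.differentiable (by norm_num)
  have h0 (t) : HasDerivAt A (deriv A t) t := (hDA t).hasDerivAt
  have h1 (t) : HasDerivAt (deriv A) (deriv (deriv A) t) t := (hDA1 t).hasDerivAt
  have h2 (t) : HasDerivAt (deriv (deriv A)) (deriv (deriv (deriv A)) t) t :=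
    (hDA2 t).hasDerivAt
  have hψ1 : deriv ψ = fun t =>
      2 / m * (deriv (deriv A) t * A t - deriv A t * deriv A t) / A t ^ 2 := by
    funext t
    rw [hψ]
    refine HasDerivAt.deriv
      (((((h1 t).const_mul (2 / m)).div (h0 t) (hA0 t)).add_const lam).congr_deriv ?_)
    ring
  have hψ2 : deriv (deriv ψ) (p 0) = 2 / m *
      ((deriv (deriv (deriv A)) (p 0) * A (p 0) - deriv (deriv A) (p 0) * deriv A (p 0)) *
        A (p 0) ^ 2 - (deriv (deriv A) (p 0) * A (p 0) - deriv A (p 0) ^ 2) *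
        (2 * A (p 0) * deriv A (p 0))) / A (p 0) ^ 4 := by
    rw [hψ1]
    refine HasDerivAt.deriv ((((((h2 (p 0)).mul (h0 (p 0))).sub
      ((h1 (p 0)).mul (h1 (p 0)))).const_mul (2 / m)).div ((h0 (p 0)).pow 2)
      (pow_ne_zero 2 (hA0 (p 0)))).congr_deriv ?_)
    simp
    ring
  have hVd : Differentiable ℝ V := by
    have hU' : Differentiable ℝ fun p : Fin 4 → ℝ =>
        U ![p 1, p 2 * Real.exp (-(m * p 0) / 2), p 3 * Real.exp (-(m * lam * p 0) / 2)] := by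
      refine hU.comp (differentiable_pi.2 fun i => ?_)
      fin_cases i <;> simp <;> fun_prop
    have hA' (n : ℕ) (p : Fin 4 → ℝ) : A (p 0) ^ n ≠ 0 := pow_ne_zero n (hA0 _)
    rw [hV]
    simp only [div_eq_mul_inv] at hU' ⊢
    refine ((Differentiable.mul (by fun_prop) (Differentiable.inv (by fun_prop) (hA' 2))).mul
      hU').add (Differentiable.mul (by fun_prop) (Differentiable.inv (by fun_prop)
        fun p => mul_ne_zero two_ne_zero (hA' 3 p)))
  have hγ := hasDerivAt_comp_curve_pd (hVd _) (hasDerivAt_conformalFlow_zero m lam p)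
  set u := U ![p 1, p 2 * Real.exp (-(m * p 0) / 2), p 3 * Real.exp (-(m * lam * p 0) / 2)]
    with hu
  have hcomp : (fun s => V (conformalFlow m lam p s)) = fun s =>
      (fun t => Real.exp (-(m * lam * t)) / A t ^ 2 * u + Real.exp (-(m * lam * t)) *
        (m * (lam - 1) * deriv A t + 2 * deriv (deriv A) t) / (2 * A t ^ 3))
          (p 0 + 2 / m * s) := by
    funext s
    have e1 : p 2 * Real.exp s * Real.exp (-(m * (p 0 + 2 / m * s)) / 2) =
        p 2 * Real.exp (-(m * p 0) / 2) := by
      rw [mul_assoc, ← Real.exp_add]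
      congr 2
      field_simp
      ring
    have e2 : p 3 * Real.exp (lam * s) * Real.exp (-(m * lam * (p 0 + 2 / m * s)) / 2) =
        p 3 * Real.exp (-(m * lam * p 0) / 2) := by
      rw [mul_assoc, ← Real.exp_add]
      congr 2
      field_simp
      ring
    simp [hV, hu, conformalFlow, e1, e2]
  have hE : HasDerivAt (fun t => Real.exp (-(m * lam * t)))
      (Real.exp (-(m * lam * p 0)) * -(m * lam)) (p 0) := by
    simpa using ((hasDerivAt_id (p 0)).const_mul (m * lam)).neg.exp
  have hg := ((hE.div ((h0 (p 0)).pow 2) (pow_ne_zero 2 (hA0 _))).mul_const u).add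
    ((hE.mul (((h1 (p 0)).const_mul (m * (lam - 1))).add ((h2 (p 0)).const_mul 2))).div
      (((h0 (p 0)).pow 3).const_mul 2) (mul_ne_zero two_ne_zero (pow_ne_zero 3 (hA0 _))))
  have hline : HasDerivAt (fun s : ℝ => p 0 + 2 / m * s) (2 / m) 0 := by
    simpa using ((hasDerivAt_id (0 : ℝ)).const_mul (2 / m)).const_add (p 0)
  have hgl := HasDerivAt.comp_of_eq (0 : ℝ) hg hline (by simp)
  rw [hcomp] at hγ
  have hkey := hγ.unique hgl
  simp only [conformalFlow_zero, Fin.sum_univ_four] at hkey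
  simp at hkey
  have hVp : V p = Real.exp (-(m * lam * p 0)) / A (p 0) ^ 2 * u + Real.exp (-(m * lam * p 0)) *
        (m * (lam - 1) * deriv A (p 0) + 2 * deriv (deriv A) (p 0)) / (2 * A (p 0) ^ 3) := by
    rw [hV]
  rw [hkey, hVp, hΔψ]
  simp only [hψ2]
  rw [hψ1, hψ]
  have := hA0 (p 0)
  simp
  field_simp
  ring
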